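/- arXiv:2205.09496 — 2 statements merged into one kernel-verified Lean document; each statement's English description precedes it below -/
import Mathlib

section
/- Let f : 𝕋^d → ℬ be a trigonometric polynomial, f(θ) = ∑_{0 < ‖k‖ ≤ K} f̂_k e^{2πik·θ} + f̂_0, and let ρ ∈ ℝ^d satisfy |k·ρ − n| ≥ α/Δ(‖k‖) for all nonzero k with ‖k‖ ≤ K and all n ∈ ℤ. Let w̄(x) = c·exp(−1/(x(1−x))) be the normalized bump weight with A_N = ∑_{n=0}^{N−1} w̄(n/N). Then there exist ĉ > 0 and C > 0, independent of N, such that for all sufficiently large N, ‖(1/A_N)∑_{n=0}^{N−1} w̄(n/N) f(θ + nρ) − f̂_0‖ ≤ C·exp(−N^{ĉ}) uniformly in θ. -/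
open scoped BigOperators Real
open Complex

/-- `‖k‖ = |k₁| + ⋯ + |k_d|` as a real number. -/
noncomputable def intNorm {d : ℕ} (k : Fin d → ℤ) : ℝ := ∑ i, |(k i : ℝ)|

/-- Normalizing constant `c = (∫₀¹ exp(-1/(s(1-s))) ds)⁻¹`. -/
noncomputable def cbar : ℝ := (∫ s in (0:ℝ)..1, Real.exp (-(s * (1 - s))⁻¹))⁻¹

/-- The bump weight `w̄(x) = c · exp(-1/(x(1-x)))` on `(0,1)`, `0` elsewhere. -/
noncomputable def wbar : ℝ → ℝ := fun x =>
  if 0 < x ∧ x < 1 then cbar * Real.exp (-(x * (1 - x))⁻¹) else 0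


lemma aux_fwd (δ h : ℝ) (hδ : 0 < δ) (hh : 0 < h) (L : ℕ) :
    ∀ (g : ℂ → ℂ) (a b M : ℝ), DifferentiableOn ℂ g {z | a < z.re ∧ z.re < b} →
      (∀ z : ℂ, a < z.re → z.re < b → ‖g z‖ ≤ M) →
      ∀ z : ℂ, a + L * δ < z.re → z.re < b - L * (δ + h) →
        ‖(fwdDiff (h : ℂ))^[L] g z‖ ≤ M * (h / δ) ^ L := by
  induction L with
  | zero =>
    intro g a b M hd hM z h1 h2
    simp at h1 h2 ⊢
    exact hM z h1 h2
  | succ L ih =>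
    intro g a b M hd hM z h1 h2
    push_cast at h1 h2
    rw [Function.iterate_succ_apply]
    have hopen : IsOpen {z : ℂ | a < z.re ∧ z.re < b} :=
      (isOpen_lt continuous_const Complex.continuous_re).inter
        (isOpen_lt Complex.continuous_re continuous_const)
    have key := ih (fwdDiff (h : ℂ) g) (a + δ) (b - δ - h) (M * (h / δ)) ?_ ?_ z
      (by linarith) (by linarith)
    · rw [pow_succ]
      calc _ ≤ _ := key
        _ = _ := by ring
    · unfold fwdDiff
      apply DifferentiableOn.sub
      · apply hd.comp (t := {z | a < z.re ∧ z.re < b})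
        · fun_prop
        · intro y hy
          simp only [Set.mem_ofPred_eq, Complex.add_re, Complex.ofReal_re] at hy ⊢
          constructor <;> linarith [hy.1, hy.2]
      · apply hd.mono
        intro y hy
        simp only [Set.mem_ofPred_eq] at hy ⊢
        constructor <;> linarith [hy.1, hy.2]
    · intro y hy1 hy2
      have hconv : Convex ℝ {z : ℂ | a + δ < z.re ∧ z.re < b - δ} :=
        (convex_halfSpace_re_gt _).inter (convex_halfSpace_re_lt _)
      have := hconv.norm_image_sub_le_of_norm_deriv_le (𝕜 := ℂ) (f := g) (C := M / δ)
        (x := y) (y := y + h) ?_ ?_ ?_ ?_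
      · unfold fwdDiff
        calc _ ≤ _ := this
          _ = _ := by
            simp [abs_of_pos hh]; ring
      · intro x hx
        simp only [Set.mem_ofPred_eq] at hx
        apply hd.differentiableAt
        apply hopen.mem_nhds
        simp only [Set.mem_ofPred_eq]
        constructor <;> linarith [hx.1, hx.2]
      · intro x hx
        simp only [Set.mem_ofPred_eq] at hx
        have hsub : Metric.closedBall x δ ⊆ {z : ℂ | a < z.re ∧ z.re < b} := by
          intro u hu
          have h3 : |(u - x).re| ≤ δ :=
            (Complex.abs_re_le_norm _).trans (by simpa [dist_eq_norm] using hu)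
          rw [Complex.sub_re, abs_le] at h3
          simp only [Set.mem_ofPred_eq]
          constructor <;> linarith [hx.1, hx.2, h3.1, h3.2]
        apply Complex.norm_deriv_le_of_forall_mem_sphere_norm_le hδ
        · apply DifferentiableOn.diffContOnCl
          rw [closure_ball _ hδ.ne']
          exact hd.mono hsub
        · intro u hu
          have := hsub (Metric.sphere_subset_closedBall hu)
          exact hM u this.1 this.2
      · simp only [Set.mem_ofPred_eq]
        constructor <;> linarith
      · simp only [Set.mem_ofPred_eq, Complex.add_re, Complex.ofReal_re]
        constructor <;> linarith

noncomputable def gfun (z : ℂ) : ℂ := Complex.exp (-(z * (1 - z))⁻¹)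

lemma gfun_diff : DifferentiableOn ℂ gfun {z | 0 < z.re ∧ z.re < 1} := by
  unfold gfun
  intro z hz
  have h1 : z ≠ 0 := by rintro rfl; simp at hz
  have h2 : 1 - z ≠ 0 := by
    intro h
    have : z = 1 := by linear_combination -h
    subst this; simp at hz
  apply DifferentiableAt.differentiableWithinAt
  have : z * (1 - z) ≠ 0 := mul_ne_zero h1 h2
  fun_prop (disch := assumption)

lemma gfun_bound (z : ℂ) (h0 : 0 < z.re) (h1' : z.re < 1) : ‖gfun z‖ ≤ 1 := by
  unfold gfun
  have h1 : z ≠ 0 := by rintro rfl; simp at h0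
  have h2 : 1 - z ≠ 0 := by
    intro h
    have : z = 1 := by linear_combination -h
    subst this; simp at h1'
  rw [Complex.norm_exp]
  apply Real.exp_le_one_iff.2
  have : (z * (1 - z))⁻¹ = z⁻¹ + (1 - z)⁻¹ := by field_simp; ring
  rw [this, Complex.neg_re, Complex.add_re, Complex.inv_re, Complex.inv_re]
  have a1 : 0 ≤ z.re / Complex.normSq z := div_nonneg h0.le (Complex.normSq_nonneg _)
  have a2 : 0 ≤ (1 - z).re / Complex.normSq (1 - z) := by
    apply div_nonneg _ (Complex.normSq_nonneg _)
    simp; linarith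
  linarith

lemma aux_hasSum (z : ℂ) (hz : z ≠ 0) (L : ℕ) : ∀ (a : ℤ → ℂ) (S : ℂ),
    HasSum (fun n => a n * z ^ n) S →
    HasSum (fun n => ((fwdDiff (1 : ℤ))^[L] a) n * z ^ n) ((z⁻¹ - 1) ^ L * S) := by
  induction L with
  | zero => intro a S h; simpa using h
  | succ L ih =>
    intro a S h
    rw [Function.iterate_succ_apply, pow_succ, mul_assoc]
    apply ih
    have h2 := (((Equiv.addRight (1:ℤ)).hasSum_iff).2 h).mul_left z⁻¹
    have h3 := h2.sub h
    have e1 : (z⁻¹ - 1) * S = z⁻¹ * S - S := by ring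
    rw [e1]
    refine Eq.mp (congrArg (fun u : ℤ → ℂ => HasSum u (z⁻¹ * S - S)) (funext fun n => ?_)) h3
    symm
    simp only [fwdDiff, Function.comp, Equiv.coe_addRight]
    rw [zpow_add₀ hz]
    field_simp

lemma cbar_pos : 0 < cbar := by
  unfold cbar
  apply inv_pos.2
  apply intervalIntegral.intervalIntegral_pos_of_pos_on _ _ one_pos
  · rw [intervalIntegrable_iff]
    apply MeasureTheory.Measure.integrableOn_of_bounded (M := 1)
    · simp
    · apply Measurable.aestronglyMeasurable
      fun_prop
    · filter_upwards [MeasureTheory.ae_restrict_mem measurableSet_uIoc] with x hx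
      rw [Set.uIoc_of_le zero_le_one] at hx
      rw [Real.norm_eq_abs, abs_of_pos (Real.exp_pos _)]
      apply Real.exp_le_one_iff.2
      have : 0 ≤ x * (1 - x) := mul_nonneg hx.1.le (by linarith [hx.2])
      have := inv_nonneg.2 this
      linarith
  · intro x hx
    exact Real.exp_pos _

lemma wbar_nonneg (x : ℝ) : 0 ≤ wbar x := by
  unfold wbar
  split_ifs
  · exact mul_nonneg cbar_pos.le (Real.exp_pos _).le
  · exact le_rfl

/-- lower bound of the normalizing sum -/
lemma AN_lower (N : ℕ) (hN : 4 ≤ N) :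
    cbar * Real.exp (-8) ≤ ∑ n ∈ Finset.range N, wbar (n / N) := by
  have hmem : N / 2 ∈ Finset.range N := by simp; omega
  refine le_trans ?_ (Finset.single_le_sum (f := fun n : ℕ => wbar (n / N))
    (fun n _ => wbar_nonneg _) hmem)
  have hN' : (0:ℝ) < N := by positivity
  have e1 : (N:ℝ) ≤ 4 * ((N / 2 : ℕ) : ℝ) := by exact_mod_cast (by omega : N ≤ 4 * (N / 2))
  have e2 : 2 * ((N / 2 : ℕ) : ℝ) ≤ N := by exact_mod_cast (by omega : 2 * (N / 2) ≤ N)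
  have f1 : (1/4:ℝ) ≤ ((N / 2 : ℕ) : ℝ) / N := by rw [le_div_iff₀ hN']; linarith
  have f2 : ((N / 2 : ℕ) : ℝ) / N ≤ 1 / 2 := by rw [div_le_iff₀ hN']; linarith
  show _ ≤ wbar (((N / 2 : ℕ) : ℝ) / N)
  set x := ((N / 2 : ℕ) : ℝ) / N
  unfold wbar
  rw [if_pos ⟨by linarith, by linarith⟩]
  apply mul_le_mul_of_nonneg_left _ cbar_pos.le
  apply Real.exp_le_exp.2
  apply neg_le_neg
  rw [inv_le_comm₀ (by nlinarith) (by norm_num)]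
  nlinarith

lemma wbar_edge (x ε : ℝ) (hε : 0 < ε) (h : x ≤ ε ∨ 1 - x ≤ ε) :
    wbar x ≤ cbar * Real.exp (-ε⁻¹) := by
  unfold wbar
  split_ifs with hx
  · apply mul_le_mul_of_nonneg_left _ cbar_pos.le
    apply Real.exp_le_exp.2
    apply neg_le_neg
    apply inv_anti₀ (mul_pos hx.1 (by linarith [hx.2]))
    rcases h with h | h <;> nlinarith [hx.1, hx.2]
  · exact mul_nonneg cbar_pos.le (Real.exp_pos _).le

/-- weight sequence on integers -/
noncomputable def aseq (N : ℕ) (n : ℤ) : ℂ := ((wbar (n / N) : ℝ) : ℂ)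

lemma aseq_zero (N : ℕ) (n : ℤ) (h : n ≤ 0 ∨ (N:ℤ) ≤ n) : aseq N n = 0 := by
  unfold aseq wbar
  rw [if_neg]
  · simp
  rintro ⟨h1, h2⟩
  rcases Nat.eq_zero_or_pos N with rfl | hN
  · simp at h1
  have hN' : (0:ℝ) < N := by positivity
  rcases h with h | h
  · have : (n:ℝ) ≤ 0 := by exact_mod_cast h
    have := div_nonpos_of_nonpos_of_nonneg this hN'.le
    linarith
  · have : (N:ℝ) ≤ n := by exact_mod_cast h
    rw [div_lt_one hN'] at h2
    linarith

lemma aseq_hasSum (N : ℕ) (z : ℂ) : HasSum (fun n : ℤ => aseq N n * z ^ n)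
    (∑ n ∈ Finset.range N, ((wbar (n / N) : ℝ) : ℂ) * z ^ n) := by
  have : (∑ n ∈ Finset.range N, ((wbar (n / N) : ℝ) : ℂ) * z ^ n) =
      ∑ n ∈ (Finset.range N).map Nat.castEmbedding, aseq N n * z ^ n := by
    rw [Finset.sum_map]
    apply Finset.sum_congr rfl
    intro n _
    simp [aseq]
  rw [this]
  apply hasSum_sum_of_ne_finset_zero
  intro n hn
  rw [aseq_zero, zero_mul]
  by_contra hcon
  push Not at hcon
  apply hn
  simp only [Finset.mem_map, Finset.mem_range, Nat.castEmbedding_apply]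
  exact ⟨n.toNat, by omega, by simp; omega⟩

lemma fwd_mid (N L : ℕ) (hN : 0 < N) (n : ℤ) (h0 : 0 < n) (h1 : n + L < N) :
    (fwdDiff (1:ℤ))^[L] (aseq N) n =
      cbar * (fwdDiff (((1 / N : ℝ)) : ℂ))^[L] gfun ((n / N : ℝ) : ℂ) := by
  rw [fwdDiff_iter_eq_sum_shift, fwdDiff_iter_eq_sum_shift, Finset.mul_sum]
  apply Finset.sum_congr rfl
  intro k hk
  have hk' : k ≤ L := by simp at hk; omega
  have hN' : (0:ℝ) < N := by positivity
  have hx : 0 < (((n + k : ℤ)) : ℝ) / N ∧ (((n + k : ℤ)) : ℝ) / N < 1 := by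
    constructor
    · have : (0:ℝ) < ((n + k : ℤ) : ℝ) := by exact_mod_cast (by omega : 0 < n + k)
      positivity
    · rw [div_lt_one hN']
      exact_mod_cast (by omega : n + k < N)
  have : aseq N (n + k • (1:ℤ)) = cbar * gfun (((n / N : ℝ) : ℂ) + k • (((1 / N : ℝ)) : ℂ)) := by
    have e : ((n / N : ℝ) : ℂ) + k • (((1 / N : ℝ)) : ℂ) = (((((n + k : ℤ)) : ℝ) / N : ℝ) : ℂ) := by
      push_cast
      simp only [nsmul_eq_mul]
      ring
    rw [e]
    unfold aseq wbar gfun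
    rw [show n + k • (1:ℤ) = n + k by simp, if_pos hx]
    push_cast
    rfl
  rw [this]
  simp only [zsmul_eq_mul]
  ring

lemma fwd_edge (N L : ℕ) (n : ℤ) (ε : ℝ) (hε : ∀ k : ℕ, k ≤ L → ‖aseq N (n + k)‖ ≤ ε) :
    ‖(fwdDiff (1:ℤ))^[L] (aseq N) n‖ ≤ 2 ^ L * ε := by
  rw [fwdDiff_iter_eq_sum_shift]
  have h2 : (2:ℝ) ^ L = ∑ k ∈ Finset.range (L + 1), (L.choose k : ℝ) := by
    exact_mod_cast (Nat.sum_range_choose L).symm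
  rw [h2, Finset.sum_mul]
  apply norm_sum_le_of_le
  intro k hk
  have hk' : k ≤ L := by simp at hk; omega
  rw [zsmul_eq_mul, norm_mul]
  apply mul_le_mul _ _ (norm_nonneg _) (by positivity)
  · simp
  · simpa using hε k hk'

lemma aux_all (N L : ℕ) (hL : 2 ≤ L) (hLN : L ^ 4 ≤ N) (n : ℤ) :
    ‖(fwdDiff (1:ℤ))^[L] (aseq N) n‖ ≤
      cbar * ((1 / L : ℝ) ^ L + 2 ^ L * Real.exp (-(L ^ 2 / 2))) := by
  have hNpos : 0 < N := lt_of_lt_of_le (by positivity) hLN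
  have hN' : (0:ℝ) < N := by positivity
  have hL' : (2:ℝ) ≤ L := by exact_mod_cast hL
  have hLpos : (0:ℝ) < L := by linarith
  have hLN' : (L:ℝ) ^ 4 ≤ N := by exact_mod_cast hLN
  have hc := cbar_pos
  have hLNle : (L:ℝ) / N ≤ 1 / L ^ 3 := by
    rw [div_le_div_iff₀ hN' (by positivity)]
    nlinarith
  have h32 : 1 / (L:ℝ) ^ 3 ≤ 1 / L ^ 2 := by
    apply one_div_le_one_div_of_le (by positivity)
    exact pow_le_pow_right₀ (by linarith) (by norm_num)
  by_cases hmid : 1 / (L:ℝ) ^ 2 < n / N ∧ (n:ℝ) / N < 1 - (1 / (L:ℝ) ^ 2 + L / N)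
  · obtain ⟨hm1, hm2⟩ := hmid
    have hp2 : 0 < 1 / (L:ℝ) ^ 2 := by positivity
    have hn0 : 0 < n := by
      have : 0 < (n:ℝ) / N := by linarith
      have := (div_pos_iff_of_pos_right hN').1 this
      exact_mod_cast this
    have hn1 : n + L < N := by
      have : ((n:ℝ) + L) / N < 1 := by rw [add_div]; linarith
      rw [div_lt_one hN'] at this
      exact_mod_cast this
    rw [fwd_mid N L hNpos n hn0 hn1]
    have e1 : (L:ℝ) * (1 / L ^ 3) = 1 / L ^ 2 := by field_simp
    have key := aux_fwd (1 / L ^ 3) (1 / N) (by positivity) (by positivity) L gfun 0 1 1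
      gfun_diff gfun_bound ((n / N : ℝ) : ℂ) (by rw [Complex.ofReal_re, e1]; linarith)
      (by rw [Complex.ofReal_re, mul_add, e1, mul_one_div]; linarith)
    rw [norm_mul, Complex.norm_real, Real.norm_eq_abs, abs_of_pos hc]
    apply mul_le_mul_of_nonneg_left _ hc.le
    have e2 : ((1:ℝ) / N / (1 / L ^ 3)) ^ L ≤ (1 / L) ^ L := by
      apply pow_le_pow_left₀ (by positivity)
      rw [div_div_eq_mul_div, div_one, div_mul_eq_mul_div, one_mul, div_le_div_iff₀ hN' hLpos]
      nlinarith
    have : 0 ≤ (2:ℝ) ^ L * Real.exp (-(L ^ 2 / 2)) := by positivity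
    linarith
  · have hedge := fwd_edge N L n (cbar * Real.exp (-(L ^ 2 / 2))) ?_
    · refine hedge.trans ?_
      have : 0 ≤ (1 / L : ℝ) ^ L := by positivity
      nlinarith
    · intro k hk
      have hk' : (k:ℝ) ≤ L := by exact_mod_cast hk
      have hkN : (k:ℝ) / N ≤ L / N := by gcongr
      have hk0 : 0 ≤ (k:ℝ) / N := by positivity
      unfold aseq
      rw [Complex.norm_real, Real.norm_eq_abs, abs_of_nonneg (wbar_nonneg _)]
      have e : ((L:ℝ) ^ 2 / 2) = (2 / (L:ℝ) ^ 2)⁻¹ := by rw [inv_div]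
      rw [e]
      apply wbar_edge _ _ (by positivity)
      push_cast
      have e3 : 2 / (L:ℝ) ^ 2 = 1 / L ^ 2 + 1 / L ^ 2 := by ring
      rw [add_div, e3]
      rw [not_and_or] at hmid
      push Not at hmid
      rcases hmid with h | h
      · left; linarith
      · right; linarith

lemma sum_bound (N L : ℕ) (hL : 2 ≤ L) (hLN : L ^ 4 ≤ N) (z : ℂ) (hz : ‖z‖ = 1) (hz1 : z ≠ 1) :
    ‖∑ n ∈ Finset.range N, ((wbar (n / N) : ℝ) : ℂ) * z ^ n‖ ≤
      (‖z⁻¹ - 1‖⁻¹) ^ L * ((N + L + 1) *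
        (cbar * ((1 / L : ℝ) ^ L + 2 ^ L * Real.exp (-(L ^ 2 / 2))))) := by
  have hz0 : z ≠ 0 := by rintro rfl; simp at hz
  have hq : 0 < ‖z⁻¹ - 1‖ := by
    rw [norm_pos_iff, sub_ne_zero]
    intro h; apply hz1; simpa using h
  have h := aux_hasSum z hz0 L _ _ (aseq_hasSum N z)
  set S := ∑ n ∈ Finset.range N, ((wbar (n / N) : ℝ) : ℂ) * z ^ n
  have h' : HasSum (fun n => ((fwdDiff (1 : ℤ))^[L] (aseq N)) n * z ^ n)
      (∑ n ∈ Finset.Icc (-L : ℤ) N, ((fwdDiff (1 : ℤ))^[L] (aseq N)) n * z ^ n) := by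
    apply hasSum_sum_of_ne_finset_zero
    intro n hn
    have hn' : n + L ≤ 0 ∨ (N:ℤ) ≤ n := by
      simp only [Finset.mem_Icc] at hn
      omega
    have := fwd_edge N L n 0 (by
      intro k hk
      rw [aseq_zero _ _ (by omega)]; simp)
    rw [mul_zero] at this
    rw [norm_le_zero_iff.1 this, zero_mul]
  have heq := h.unique h'
  have hS : ‖z⁻¹ - 1‖ ^ L * ‖S‖ ≤ (N + L + 1) *
        (cbar * ((1 / L : ℝ) ^ L + 2 ^ L * Real.exp (-(L ^ 2 / 2)))) := by
    rw [← norm_pow, ← norm_mul, heq]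
    refine (norm_sum_le_of_le _ (f := fun n : ℤ => ((fwdDiff (1 : ℤ))^[L] (aseq N)) n * z ^ n) (n := fun _ => cbar * ((1 / L : ℝ) ^ L + 2 ^ L * Real.exp (-(L ^ 2 / 2)))) ?_).trans ?_
    · intro n _
      rw [norm_mul, norm_zpow, hz, one_zpow, mul_one]
      exact aux_all N L hL hLN n
    · rw [Finset.sum_const, nsmul_eq_mul]
      apply le_of_eq
      congr 1
      rw [Int.card_Icc]
      have : ((N:ℤ) + 1 - -(L:ℤ)).toNat = N + L + 1 := by omega
      rw [this]; push_cast; ring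
  rw [inv_pow, inv_mul_eq_div, le_div_iff₀ (by positivity)]
  linarith

lemma eventually_bound (z : ℂ) (hz : ‖z‖ = 1) (hz1 : z ≠ 1) :
    ∀ᶠ N : ℕ in Filter.atTop,
      ‖∑ n ∈ Finset.range N, ((wbar (n / N) : ℝ) : ℂ) * z ^ n‖ ≤
        cbar * 864 * Real.exp (-(N:ℝ) ^ (1/4 : ℝ)) := by
  set q := ‖z⁻¹ - 1‖⁻¹ with hqdef
  have hq0 : 0 ≤ q := by positivity
  set Q := q * Real.exp 3 with hQ
  have hQ0 : 0 ≤ Q := by positivity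
  obtain ⟨m, hm⟩ := exists_nat_ge (4 * Q + 2)
  filter_upwards [Filter.eventually_ge_atTop ((m ^ 2) ^ 2)] with N hN
  set L := Nat.sqrt (Nat.sqrt N) with hLdef
  have hmL : m ≤ L := by
    rw [hLdef, Nat.le_sqrt', Nat.le_sqrt']; exact hN
  have hLm' : (m:ℝ) ≤ L := by exact_mod_cast hmL
  have hL2' : (2:ℝ) ≤ L := by linarith
  have hL2 : 2 ≤ L := by exact_mod_cast hL2'
  have hLQ : 4 * Q ≤ L := by linarith
  have hLpos : (0:ℝ) < L := by linarith
  have hLN : L ^ 4 ≤ N := by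
    have h1 : L ^ 2 ≤ Nat.sqrt N := Nat.sqrt_le' _
    have h2 : Nat.sqrt N ^ 2 ≤ N := Nat.sqrt_le' _
    calc L ^ 4 = (L ^ 2) ^ 2 := by ring
      _ ≤ (Nat.sqrt N) ^ 2 := Nat.pow_le_pow_left h1 2
      _ ≤ N := h2
  have hNL : N ≤ (2 * L) ^ 4 := by
    have h1 : Nat.sqrt N < (L + 1) ^ 2 := Nat.lt_succ_sqrt' _
    have h2 : N < (Nat.sqrt N + 1) ^ 2 := Nat.lt_succ_sqrt' _
    calc N ≤ (Nat.sqrt N + 1) ^ 2 := h2.le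
      _ ≤ ((L + 1) ^ 2) ^ 2 := Nat.pow_le_pow_left h1 2
      _ = (L + 1) ^ 4 := by ring
      _ ≤ (2 * L) ^ 4 := Nat.pow_le_pow_left (by omega) 4
  have hNL' : (N:ℝ) ≤ (2 * L) ^ 4 := by exact_mod_cast hNL
  have hroot : (N:ℝ) ^ (1/4 : ℝ) ≤ 2 * L := by
    calc (N:ℝ) ^ (1/4 : ℝ) ≤ ((2 * L : ℝ) ^ 4) ^ (1/4 : ℝ) :=
          Real.rpow_le_rpow (by positivity) hNL' (by norm_num)
      _ = 2 * L := by
          rw [← Real.rpow_natCast, ← Real.rpow_mul (by positivity)]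
          norm_num
  have hb := sum_bound N L hL2 hLN z hz hz1
  rw [← hqdef] at hb
  have hpoly : ((N:ℝ) + L + 1) ≤ 432 * Real.exp L := by
    have h4 := Real.pow_div_factorial_le_exp (L:ℝ) hLpos.le 4
    have h24 : ((Nat.factorial 4 : ℕ) : ℝ) = 24 := by norm_num [Nat.factorial]
    rw [h24] at h4
    have hL4 : (L:ℝ) ≤ L ^ 4 := le_self_pow₀ (by linarith) (by norm_num)
    nlinarith
  have hE : ∀ t : ℝ, Real.exp (t * L) = Real.exp t ^ L := by
    intro t; rw [mul_comm, Real.exp_nat_mul]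
  have t1 : Q ^ L * (1 / L : ℝ) ^ L ≤ 1 := by
    rw [← mul_pow]
    apply pow_le_one₀ (by positivity)
    rw [mul_one_div, div_le_one hLpos]
    linarith
  have t2 : Q ^ L * (2 ^ L * Real.exp (-(L ^ 2 / 2))) ≤ 1 := by
    have : Real.exp (-((L:ℝ) ^ 2 / 2)) = Real.exp (-(L / 2)) ^ L := by
      rw [← hE]; congr 1; ring
    rw [this, ← mul_pow, ← mul_pow]
    apply pow_le_one₀ (by positivity)
    rw [Real.exp_neg, ← mul_assoc, ← div_eq_mul_inv, div_le_one (Real.exp_pos _)]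
    have := Real.add_one_le_exp ((L:ℝ) / 2)
    linarith
  have hQL : Q ^ L = q ^ L * Real.exp (2 * L) * Real.exp L := by
    rw [hQ, mul_pow, ← hE, mul_assoc, ← Real.exp_add]
    congr 2; ring
  have hc := cbar_pos
  set W := (1 / L : ℝ) ^ L + 2 ^ L * Real.exp (-(L ^ 2 / 2)) with hW
  have hW0 : 0 ≤ W := by positivity
  have t3 : Q ^ L * W ≤ 2 := by rw [hW, mul_add]; linarith
  calc _ ≤ _ := hb
    _ ≤ q ^ L * ((432 * Real.exp L) * (cbar * W)) := by gcongr
    _ = 432 * cbar * (Q ^ L * W) * Real.exp (-(2 * L)) := by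
        rw [hQL, Real.exp_neg]
        field_simp
    _ ≤ 432 * cbar * 2 * Real.exp (-(2 * L)) := by gcongr
    _ ≤ 432 * cbar * 2 * Real.exp (-(N:ℝ) ^ (1/4 : ℝ)) := by gcongr
    _ = _ := by ring


/-- exponential convergence of the discrete weighted Birkhoff average,
with the bump weight `w̄`, for a trigonometric polynomial observable (frequencies
`‖k‖ ≤ K`) over a rotation nonresonant on those frequencies. -/
theorem stmt16
    {B : Type*} [NormedAddCommGroup B] [NormedSpace ℂ B] [CompleteSpace B]
    (d : ℕ) (hd : 1 ≤ d) (K : ℝ) (hK : 1 ≤ K)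
    (f : (Fin d → ℝ) → B) (fhat : (Fin d → ℤ) → B)
    (hpoly : ∀ k : Fin d → ℤ, K < intNorm k → fhat k = 0)
    (hf : ∀ θ : Fin d → ℝ,
      HasSum (fun k : Fin d → ℤ =>
        Complex.exp (2 * π * Complex.I * (∑ i, (k i : ℝ) * θ i)) • fhat k) (f θ))
    (Δ : ℝ → ℝ) (hΔmono : StrictMonoOn Δ (Set.Ici 1)) (hΔge : ∀ x ≥ (1:ℝ), 1 ≤ Δ x)
    (α : ℝ) (hα : 0 < α) (ρ : Fin d → ℝ)
    (hρ : ∀ k : Fin d → ℤ, k ≠ 0 → intNorm k ≤ K → ∀ n : ℤ,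
      α / Δ (intNorm k) ≤ |(∑ i, (k i : ℝ) * ρ i) - n|) :
    ∃ chat C : ℝ, ∃ N₀ : ℕ, 0 < chat ∧ 0 < C ∧
      ∀ N : ℕ, N₀ ≤ N → ∀ θ : Fin d → ℝ,
        ‖((∑ n ∈ Finset.range N, wbar (n / N) : ℝ) : ℂ)⁻¹ •
            (∑ n ∈ Finset.range N, ((wbar (n / N) : ℝ) : ℂ) • f (θ + (n : ℝ) • ρ)) -
          fhat 0‖ ≤ C * Real.exp (-(N : ℝ) ^ chat) := by
  classical
  set F : Finset (Fin d → ℤ) := Finset.Icc (fun _ => -⌈K⌉) (fun _ => ⌈K⌉) with hF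
  have hFmem : ∀ k, intNorm k ≤ K → k ∈ F := by
    intro k hk
    have : ∀ i, |k i| ≤ ⌈K⌉ := by
      intro i
      have h1 : |(k i : ℝ)| ≤ intNorm k :=
        Finset.single_le_sum (f := fun i => |(k i : ℝ)|) (fun _ _ => abs_nonneg _)
          (Finset.mem_univ i)
      have h2 := (h1.trans hk).trans (Int.le_ceil K)
      exact_mod_cast h2
    rw [hF, Finset.mem_Icc]
    exact ⟨fun i => (abs_le.1 (this i)).1, fun i => (abs_le.1 (this i)).2⟩
  have h0F : (0 : Fin d → ℤ) ∈ F := by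
    apply hFmem
    simp [intNorm]; linarith
  have hfF : ∀ θ, f θ = ∑ k ∈ F,
      Complex.exp (2 * π * Complex.I * (∑ i, (k i : ℝ) * θ i)) • fhat k := by
    intro θ
    refine (hf θ).unique (hasSum_sum_of_ne_finset_zero ?_)
    intro k hk
    rw [hpoly k, smul_zero]
    by_contra hcon
    exact hk (hFmem k (not_lt.1 hcon))
  set ζ : (Fin d → ℤ) → ℂ := fun k =>
    Complex.exp (2 * π * Complex.I * (∑ i, (k i : ℝ) * ρ i)) with hζ
  have hnorm : ∀ (k : Fin d → ℤ) (θ : Fin d → ℝ),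
      ‖Complex.exp (2 * π * Complex.I * (∑ i, (k i : ℝ) * θ i))‖ = 1 := by
    intro k θ
    have : (2 * π * Complex.I * (∑ i, (k i : ℝ) * θ i) : ℂ) =
        ((2 * π * (∑ i, (k i : ℝ) * θ i) : ℝ) : ℂ) * Complex.I := by
      push_cast; ring
    rw [this, Complex.norm_exp_ofReal_mul_I]
  have hζ1 : ∀ k, k ≠ 0 → intNorm k ≤ K → ζ k ≠ 1 := by
    intro k hk hkK h
    rw [hζ] at h
    simp only at h
    rw [Complex.exp_eq_one_iff] at h
    obtain ⟨n, hn⟩ := h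
    have h2 : ((∑ i, (k i : ℝ) * ρ i : ℝ) : ℂ) = ((n : ℝ) : ℂ) := by
      have hne : (2 * π * Complex.I : ℂ) ≠ 0 := Complex.two_pi_I_ne_zero
      apply mul_left_cancel₀ hne
      push_cast at hn ⊢
      rw [hn]; ring
    have h3 : (∑ i, (k i : ℝ) * ρ i : ℝ) = n := Complex.ofReal_injective h2
    have h4 := hρ k hk hkK n
    rw [h3, sub_self, abs_zero] at h4
    have h5 : 1 ≤ intNorm k := by
      obtain ⟨i, hi⟩ := Function.ne_iff.1 hk
      have h1 : |(k i : ℝ)| ≤ intNorm k :=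
        Finset.single_le_sum (f := fun i => |(k i : ℝ)|) (fun _ _ => abs_nonneg _)
          (Finset.mem_univ i)
      have h6 : (1:ℝ) ≤ |(k i : ℝ)| := by exact_mod_cast Int.one_le_abs hi
      linarith
    have h6 : 0 < α / Δ (intNorm k) := div_pos hα (by linarith [hΔge _ h5])
    linarith
  have hev : ∀ᶠ N : ℕ in Filter.atTop, ∀ k ∈ F, (k ≠ 0 ∧ intNorm k ≤ K) →
      ‖∑ n ∈ Finset.range N, ((wbar (n / N) : ℝ) : ℂ) * ζ k ^ n‖ ≤
        cbar * 864 * Real.exp (-(N:ℝ) ^ (1/4 : ℝ)) := by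
    rw [Filter.eventually_all_finset]
    intro k _
    by_cases hk : k ≠ 0 ∧ intNorm k ≤ K
    · filter_upwards [eventually_bound (ζ k) (hnorm k ρ) (hζ1 k hk.1 hk.2)] with N hN _
      exact hN
    · exact Filter.Eventually.of_forall fun N h => absurd h hk
  obtain ⟨N₁, hN₁⟩ := Filter.eventually_atTop.1 hev
  set M := ∑ k ∈ F, ‖fhat k‖ with hM
  have hM0 : 0 ≤ M := Finset.sum_nonneg fun _ _ => norm_nonneg _
  have hc := cbar_pos
  refine ⟨1/4, (cbar * Real.exp (-8))⁻¹ * (cbar * 864) * M + 1, max N₁ 4, by norm_num,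
    by positivity, ?_⟩
  intro N hN θ
  have hN4 : 4 ≤ N := le_trans (le_max_right _ _) hN
  have hb := hN₁ N (le_trans (le_max_left _ _) hN)
  have hA := AN_lower N hN4
  set A : ℝ := ∑ n ∈ Finset.range N, wbar (n / N) with hAdef
  have hA0 : 0 < A := lt_of_lt_of_le (by positivity) hA
  have hAc : (A : ℂ) ≠ 0 := by exact_mod_cast hA0.ne'
  set e : (Fin d → ℤ) → ℂ := fun k =>
    Complex.exp (2 * π * Complex.I * (∑ i, (k i : ℝ) * θ i)) with he
  set S : (Fin d → ℤ) → ℂ := fun k =>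
    ∑ n ∈ Finset.range N, ((wbar (n / N) : ℝ) : ℂ) * ζ k ^ n with hS
  have hshift : ∀ n : ℕ, f (θ + (n : ℝ) • ρ) = ∑ k ∈ F, (e k * ζ k ^ n) • fhat k := by
    intro n
    rw [hfF]
    apply Finset.sum_congr rfl
    intro k _
    congr 1
    rw [he, hζ]
    simp only
    rw [← Complex.exp_nat_mul, ← Complex.exp_add]
    congr 1
    have : (∑ i, (k i : ℝ) * (θ + (n : ℝ) • ρ) i : ℝ) =
        (∑ i, (k i : ℝ) * θ i) + n * ∑ i, (k i : ℝ) * ρ i := by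
      rw [Finset.mul_sum, ← Finset.sum_add_distrib]
      apply Finset.sum_congr rfl
      intro i _
      simp only [Pi.add_apply, Pi.smul_apply, smul_eq_mul]
      ring
    have h2 := congrArg (fun x : ℝ => (x : ℂ)) this
    push_cast at h2 ⊢
    rw [h2]; ring
  have hsum : (∑ n ∈ Finset.range N, ((wbar (n / N) : ℝ) : ℂ) • f (θ + (n : ℝ) • ρ)) =
      ∑ k ∈ F, (e k * S k) • fhat k := by
    simp_rw [hshift, Finset.smul_sum]
    rw [Finset.sum_comm]
    apply Finset.sum_congr rfl
    intro k _
    rw [hS]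
    simp only
    rw [Finset.mul_sum, Finset.sum_smul]
    apply Finset.sum_congr rfl
    intro n _
    rw [smul_smul]
    congr 1
    ring
  have hS0 : e 0 * S 0 = A := by
    simp [he, hS, hζ, hAdef]
  rw [hsum, ← Finset.add_sum_erase _ _ h0F, hS0, smul_add, smul_smul, inv_mul_cancel₀ hAc,
    one_smul, add_sub_cancel_left, norm_smul, norm_inv, Complex.norm_real, Real.norm_eq_abs,
    abs_of_pos hA0]
  set E := Real.exp (-(N:ℝ) ^ (1/4 : ℝ)) with hE
  have hE0 : 0 < E := Real.exp_pos _
  have hsumle : ‖∑ k ∈ F.erase 0, (e k * S k) • fhat k‖ ≤ cbar * 864 * E * M := by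
    calc _ ≤ ∑ k ∈ F.erase 0, cbar * 864 * E * ‖fhat k‖ := by
          apply norm_sum_le_of_le
          intro k hk
          rw [Finset.mem_erase] at hk
          by_cases hkK : intNorm k ≤ K
          · rw [norm_smul, norm_mul, hnorm k θ, one_mul]
            exact mul_le_mul_of_nonneg_right (hb k hk.2 ⟨hk.1, hkK⟩) (norm_nonneg _)
          · rw [hpoly k (not_le.1 hkK)]; simp
      _ ≤ ∑ k ∈ F, cbar * 864 * E * ‖fhat k‖ :=
          Finset.sum_le_sum_of_subset_of_nonneg (Finset.erase_subset _ _)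
            (fun _ _ _ => by positivity)
      _ = _ := by rw [← Finset.mul_sum]
  calc _ ≤ (cbar * Real.exp (-8))⁻¹ * (cbar * 864 * E * M) := by gcongr
    _ ≤ _ := by nlinarith
end

section
/- Let ρ ∈ ℝ^d satisfy the Diophantine condition |k·ρ − n| ≥ α/‖k‖^τ for all nonzero k ∈ ℤ^d and n ∈ ℤ, with τ > d − 1, and let f : 𝕋^d → ℬ satisfy ‖f̂_k‖ ≤ c_f e^{−2μ‖k‖} for all k ≠ 0 (f real-analytic). Let w̄ be the normalized bump weight exp(−1/(x(1−x))). Then there exist ξ > 0, c̃ > 0 and C > 0 such that for all sufficiently large N, ‖(1/A_N)∑_{n=0}^{N−1} w̄(n/N) f(θ + nρ) − ∫_{𝕋^d} f dθ̂‖ ≤ C·exp(−c̃ N^{ξ}), uniformly in θ ∈ 𝕋^d. -/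
open scoped BigOperators Real
open Complex

noncomputable def bumpC (x : ℝ) : ℂ := ((expNegInvGlue (x * (1 - x)) : ℝ) : ℂ)

noncomputable def bumpF (z : ℂ) : ℂ := Complex.exp (-(z⁻¹ + (1 - z)⁻¹))

lemma bumpC_contDiff (n : ℕ) : ContDiff ℝ n bumpC := by
  have h : ContDiff ℝ n (fun x : ℝ => expNegInvGlue (x * (1 - x))) :=
    (expNegInvGlue.contDiff (n := n)).comp (by fun_prop)
  exact Complex.ofRealCLM.contDiff.comp h

lemma bumpC_eq_zero {x : ℝ} (hx : x ≤ 0 ∨ 1 ≤ x) : bumpC x = 0 := by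
  unfold bumpC
  rw [expNegInvGlue.zero_of_nonpos, Complex.ofReal_zero]
  rcases hx with h | h <;> nlinarith

lemma bumpC_eq {x : ℝ} (h0 : 0 < x) (h1 : x < 1) : bumpC x = bumpF x := by
  unfold bumpC bumpF expNegInvGlue
  have h2 : 0 < 1 - x := by linarith
  have h3 : 0 < x * (1 - x) := mul_pos h0 h2
  rw [if_neg (not_le.mpr h3)]
  have : (x * (1 - x))⁻¹ = x⁻¹ + (1 - x)⁻¹ := by
    field_simp
    ring
  rw [this]
  push_cast
  rfl

lemma bumpF_analyticAt {z : ℂ} (h0 : z ≠ 0) (h1 : z ≠ 1) : AnalyticAt ℂ bumpF z := by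
  have h2 : (1 : ℂ) - z ≠ 0 := sub_ne_zero.mpr h1.symm
  unfold bumpF
  fun_prop (disch := assumption)

lemma iteratedDeriv_bumpC (m : ℕ) : ∀ x : ℝ, 0 < x → x < 1 →
    iteratedDeriv m bumpC x = iteratedDeriv m bumpF x := by
  induction m with
  | zero => intro x h0 h1; simpa using bumpC_eq h0 h1
  | succ m ih =>
    intro x h0 h1
    have he : iteratedDeriv m bumpC =ᶠ[nhds x] fun y : ℝ => iteratedDeriv m bumpF y := by
      filter_upwards [Ioo_mem_nhds h0 h1] with y hy using ih y hy.1 hy.2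
    rw [iteratedDeriv_succ, iteratedDeriv_succ, he.deriv_eq]
    have ha : AnalyticAt ℂ (iteratedDeriv m bumpF) x := by
      have := (bumpF_analyticAt (z := (x : ℂ)) (by exact_mod_cast h0.ne')
        (by exact_mod_cast h1.ne)).iterated_deriv m
      rwa [← iteratedDeriv_eq_iterate] at this
    exact ha.differentiableAt.hasDerivAt.comp_ofReal.deriv

lemma re_inv_lower {z : ℂ} {x : ℝ} (hx : 0 < x) (hz : ‖z - x‖ ≤ x / 2) :
    2 / (9 * x) ≤ (z⁻¹).re := by
  have h1 : x / 2 ≤ z.re := by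
    have := (abs_le.mp ((Complex.abs_re_le_norm (z - x)).trans hz)).1
    simp at this; linarith
  have h2 : ‖z‖ ≤ 3 * x / 2 := by
    have : ‖z‖ ≤ ‖z - x‖ + ‖(x : ℂ)‖ := by simpa using norm_add_le (z - x) (x : ℂ)
    rw [Complex.norm_real, Real.norm_eq_abs, abs_of_pos hx] at this
    linarith
  have h3 : 0 < Complex.normSq z := by
    rw [Complex.normSq_pos]; rintro rfl; simp at h1; linarith
  rw [Complex.inv_re, div_le_div_iff₀ (by positivity) h3, Complex.normSq_eq_norm_sq]
  have : ‖z‖ ^ 2 ≤ (3 * x / 2) ^ 2 := by gcongr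
  nlinarith

lemma norm_iteratedDeriv_bumpF (m : ℕ) (x : ℝ) (h0 : 0 < x) (h1 : x < 1) :
    ‖iteratedDeriv m bumpF x‖ ≤ 9 ^ m * (m.factorial : ℝ) ^ 2 := by
  set R := min x (1 - x) / 2 with hR
  have hRp : 0 < R := by
    have : 0 < min x (1 - x) := lt_min h0 (by linarith)
    positivity
  have hR1 : R ≤ x / 2 := by have := min_le_left x (1 - x); linarith
  have hR2 : R ≤ (1 - x) / 2 := by have := min_le_right x (1 - x); linarith
  have hx1 : 0 < 1 - x := by linarith
  have key : ∀ z ∈ Metric.closedBall (x : ℂ) R, 2 / (9 * x) ≤ (z⁻¹).re ∧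
      2 / (9 * (1 - x)) ≤ ((1 - z)⁻¹).re := by
    intro z hz
    rw [Metric.mem_closedBall, dist_eq_norm] at hz
    refine ⟨re_inv_lower h0 (hz.trans hR1), re_inv_lower hx1 ?_⟩
    have : (1 - z) - ((1 - x : ℝ) : ℂ) = -(z - x) := by push_cast; ring
    rw [this, norm_neg]
    exact hz.trans hR2
  have hne : ∀ z ∈ Metric.closedBall (x : ℂ) R, z ≠ 0 ∧ z ≠ 1 := by
    intro z hz
    obtain ⟨ha, hb⟩ := key z hz
    have p1 : 0 < 2 / (9 * x) := by positivity
    have p2 : 0 < 2 / (9 * (1 - x)) := by positivity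
    constructor
    · rintro rfl; simp at ha; linarith
    · rintro rfl; simp at hb; linarith
  have hsum : 1 / (9 * R) ≤ 2 / (9 * x) + 2 / (9 * (1 - x)) := by
    have p1 : 0 < 2 / (9 * x) := by positivity
    have p2 : 0 < 2 / (9 * (1 - x)) := by positivity
    rcases min_choice x (1 - x) with h | h
    · have : 1 / (9 * R) = 2 / (9 * x) := by rw [hR, h]; field_simp
      linarith
    · have : 1 / (9 * R) = 2 / (9 * (1 - x)) := by rw [hR, h]; field_simp
      linarith
  have hb : ∀ z ∈ Metric.sphere (x : ℂ) R, ‖bumpF z‖ ≤ Real.exp (-(1 / (9 * R))) := by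
    intro z hz
    obtain ⟨ha, hb⟩ := key z (Metric.sphere_subset_closedBall hz)
    unfold bumpF
    rw [Complex.norm_exp]
    apply Real.exp_le_exp.mpr
    rw [Complex.neg_re, Complex.add_re]
    linarith
  have hd : DiffContOnCl ℂ bumpF (Metric.ball (x : ℂ) R) := by
    apply DifferentiableOn.diffContOnCl
    rw [closure_ball _ hRp.ne']
    intro z hz
    exact (bumpF_analyticAt (hne z hz).1 (hne z hz).2).differentiableAt.differentiableWithinAt
  have hC := Complex.norm_iteratedDeriv_le_of_forall_mem_sphere_norm_le m hRp hd hb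
  refine hC.trans ?_
  have hexp := Real.pow_div_factorial_le_exp (1 / (9 * R)) (by positivity) m
  have hf : 0 < (m.factorial : ℝ) := by positivity
  rw [div_le_iff₀ hf, one_div, inv_pow, mul_pow] at hexp
  rw [div_le_iff₀ (by positivity), Real.exp_neg]
  have hE := Real.exp_pos ((9 * R)⁻¹)
  rw [one_div, ← div_eq_mul_inv, div_le_iff₀ hE]
  rw [inv_le_iff_one_le_mul₀ (by positivity)] at hexp
  calc (m.factorial : ℝ) = m.factorial * 1 := by ring
    _ ≤ m.factorial * (Real.exp ((9 * R)⁻¹) * m.factorial * (9 ^ m * R ^ m)) := by gcongr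
    _ = _ := by ring

lemma norm_iteratedDeriv_bumpC (m : ℕ) (x : ℝ) :
    ‖iteratedDeriv m bumpC x‖ ≤ 9 ^ m * (m.factorial : ℝ) ^ 2 := by
  have hcl : IsClosed {x : ℝ | ‖iteratedDeriv m bumpC x‖ ≤ 9 ^ m * (m.factorial : ℝ) ^ 2} :=
    isClosed_le ((bumpC_contDiff m).continuous_iteratedDeriv' m).norm continuous_const
  have hz : ∀ y : ℝ, (y < 0 ∨ 1 < y) → iteratedDeriv m bumpC y = 0 := by
    intro y hy
    have : bumpC =ᶠ[nhds y] fun _ => 0 := by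
      rcases hy with h | h
      · filter_upwards [Iio_mem_nhds h] with t ht using bumpC_eq_zero (Or.inl (le_of_lt ht))
      · filter_upwards [Ioi_mem_nhds h] with t ht using bumpC_eq_zero (Or.inr (le_of_lt ht))
    rw [this.iteratedDeriv_eq]
    simp
  have hdense : Dense (({0, 1} : Set ℝ)ᶜ) := (Set.toFinite _).countable.dense_compl ℝ
  have hsub : ({0, 1} : Set ℝ)ᶜ ⊆
      {x : ℝ | ‖iteratedDeriv m bumpC x‖ ≤ 9 ^ m * (m.factorial : ℝ) ^ 2} := by
    intro y hy
    simp only [Set.mem_compl_iff, Set.mem_insert_iff, Set.mem_singleton_iff, not_or] at hy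
    rw [Set.mem_ofPred_eq]
    rcases lt_or_gt_of_ne hy.1 with h | h
    · rw [hz y (Or.inl h), norm_zero]; positivity
    · rcases lt_or_gt_of_ne hy.2 with h' | h'
      · rw [iteratedDeriv_bumpC m y h h']; exact norm_iteratedDeriv_bumpF m y h h'
      · rw [hz y (Or.inr h'), norm_zero]; positivity
  have := hcl.closure_subset_iff.mpr hsub
  rw [hdense.closure_eq] at this
  exact this (Set.mem_univ x)

lemma norm_fwdDiff_iter_le (m : ℕ) : ∀ (g : ℝ → ℂ) (M h : ℝ), 0 ≤ h → ContDiff ℝ m g →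
    (∀ x, ‖iteratedDeriv m g x‖ ≤ M) → ∀ x, ‖(fwdDiff h)^[m] g x‖ ≤ h ^ m * M := by
  induction m with
  | zero => intro g M h hh hg hM x; simpa using hM x
  | succ m ih =>
    intro g M h hh hg hM x
    rw [Function.iterate_succ_apply]
    have hgm : ContDiff ℝ m g := hg.of_le (by norm_cast; omega)
    have hg2 : ContDiff ℝ m (fun y => g (y + h)) := hgm.comp (by fun_prop)
    have := ih (fwdDiff h g) (h * M) h hh (hg2.sub hgm) ?_ x
    · calc _ ≤ _ := this
        _ = _ := by ring
    · intro y
      have e : iteratedDeriv m (fwdDiff h g) y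
          = iteratedDeriv m g (y + h) - iteratedDeriv m g y := by
        have := iteratedDeriv_sub (n := m) (x := y) (hg2.contDiffAt) (hgm.contDiffAt)
        rw [iteratedDeriv_comp_add_const] at this
        exact this
      rw [e]
      have hdiff := hg.differentiable_iteratedDeriv' m
      have := Convex.norm_image_sub_le_of_norm_deriv_le (f := iteratedDeriv m g) (C := M)
        (s := Set.univ) (x := y) (y := y + h) (fun z _ => hdiff z)
        (fun z _ => by rw [← iteratedDeriv_succ]; exact hM z) convex_univ trivial trivial
      rw [add_sub_cancel_left, Real.norm_eq_abs, abs_of_nonneg hh] at this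
      linarith

lemma hasSum_fwdDiff_iter {h : ℝ} {z : ℂ} (hz : z ≠ 0) (m : ℕ) : ∀ {u : ℝ → ℂ} {a : ℂ},
    HasSum (fun n : ℤ => u (n * h) * z ^ n) a →
    HasSum (fun n : ℤ => (fwdDiff h)^[m] u (n * h) * z ^ n) ((z⁻¹ - 1) ^ m * a) := by
  induction m with
  | zero => intro u a hu; simpa using hu
  | succ m ih =>
    intro u a hu
    have h1 : HasSum (fun n : ℤ => fwdDiff h u (n * h) * z ^ n) ((z⁻¹ - 1) * a) := by
      have h2 := ((Equiv.addRight (1 : ℤ)).hasSum_iff (f := fun n : ℤ => u (n * h) * z ^ n)).mpr hu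
      have h3 := (h2.mul_left z⁻¹).sub hu
      rw [show (z⁻¹ - 1) * a = z⁻¹ * a - a by ring]
      refine h3.congr_fun ?_
      intro n
      simp only [Function.comp, Equiv.coe_addRight, fwdDiff]
      rw [zpow_add_one₀ hz]
      push_cast
      rw [show ((n : ℝ) + 1) * h = n * h + h by ring]
      field_simp
    have := ih h1
    rw [Function.iterate_succ_apply, pow_succ, mul_assoc]
    exact this

lemma norm_unit_sub_one {ω δ : ℝ} (h : ∀ n : ℤ, δ ≤ |ω - n|) :
    4 * δ ≤ ‖(Complex.exp (2 * π * Complex.I * ω))⁻¹ - 1‖ := by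
  set p := ω - round ω with hp
  have hp1 : |p| ≤ 1 / 2 := abs_sub_round ω
  have hp2 : δ ≤ |p| := h (round ω)
  have e : (Complex.exp (2 * π * Complex.I * ω))⁻¹ = Complex.exp (Complex.I * ((-2 * π * p : ℝ) : ℂ)) := by
    rw [← Complex.exp_neg, Complex.exp_eq_exp_iff_exists_int]
    refine ⟨-round ω, ?_⟩
    rw [hp]; push_cast; ring
  rw [e, Complex.norm_exp_I_mul_ofReal_sub_one, Real.norm_eq_abs, abs_mul, abs_two]
  have : -2 * π * p / 2 = -(π * p) := by ring
  rw [this, Real.sin_neg, abs_neg]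
  have hpi := Real.pi_pos
  have hs := Real.mul_abs_le_abs_sin (x := π * p) (by
    rw [abs_mul, abs_of_pos hpi]; nlinarith)
  rw [abs_mul, abs_of_pos hpi] at hs
  have : 2 / π * (π * |p|) = 2 * |p| := by field_simp
  linarith

lemma exp_sum_bound (N m : ℕ) (hN : 0 < N) (ω δ : ℝ) (hδ : 0 < δ)
    (h : ∀ n : ℤ, δ ≤ |ω - n|) :
    ‖∑ n ∈ Finset.range N, bumpC (n / N) * Complex.exp (2 * π * Complex.I * ω) ^ n‖ ≤
      (N + m) * (9 * (m : ℝ) ^ 2 / (4 * δ * N)) ^ m := by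
  set z := Complex.exp (2 * π * Complex.I * ω) with hzdef
  have hz : z ≠ 0 := Complex.exp_ne_zero _
  have hz1 : ‖z‖ = 1 := by
    rw [hzdef, show 2 * π * Complex.I * ω = Complex.I * ((2 * π * ω : ℝ) : ℂ) by push_cast; ring]
    exact Complex.norm_exp_I_mul_ofReal _
  have hNR : (0 : ℝ) < N := by exact_mod_cast hN
  set a := ∑ n ∈ Finset.range N, bumpC (n / N) * z ^ n with ha
  set hh : ℝ := (N : ℝ)⁻¹ with hhh
  have hhp : 0 < hh := by positivity
  have hNh : (N : ℝ) * hh = 1 := by rw [hhh]; field_simp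
  have hsum : HasSum (fun n : ℤ => bumpC (n * hh) * z ^ n) a := by
    have h1 : HasSum (fun n : ℕ => bumpC (n / N) * z ^ n) a := by
      apply hasSum_sum_of_ne_finset_zero
      intro n hn
      rw [Finset.mem_range, not_lt] at hn
      rw [bumpC_eq_zero (Or.inr ?_), zero_mul]
      rw [le_div_iff₀ hNR]; simpa using hn
    have inj : Function.Injective (fun n : ℕ => (n : ℤ)) := Nat.cast_injective
    refine (inj.hasSum_iff ?_).mp (h1.congr_fun ?_)
    · intro n hn
      have : n < 0 := by
        by_contra hc
        exact hn ⟨n.toNat, by simp; omega⟩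
      have hn' : (n : ℝ) < 0 := by exact_mod_cast this
      rw [bumpC_eq_zero (Or.inl ?_), zero_mul]
      nlinarith
    · intro n
      simp [hhh, div_eq_mul_inv]
  have hD := hasSum_fwdDiff_iter hz m hsum
  have hfin : HasSum (fun n : ℤ => (fwdDiff hh)^[m] bumpC (n * hh) * z ^ n)
      (∑ n ∈ Finset.Ico (-(m : ℤ)) N, (fwdDiff hh)^[m] bumpC (n * hh) * z ^ n) := by
    apply hasSum_sum_of_ne_finset_zero
    intro n hn
    rw [fwdDiff_iter_eq_sum_shift, Finset.sum_eq_zero, zero_mul]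
    intro k hk
    rw [Finset.mem_range] at hk
    rw [bumpC_eq_zero, smul_zero]
    rw [Finset.mem_Ico, not_and_or, not_le, not_lt] at hn
    rcases hn with hn | hn
    · left
      have : (n : ℝ) + k ≤ 0 := by
        have : n + (k : ℤ) ≤ 0 := by omega
        exact_mod_cast this
      rw [nsmul_eq_mul]; nlinarith
    · right
      have : (N : ℝ) ≤ n := by exact_mod_cast hn
      rw [nsmul_eq_mul]
      have hk0 : (0 : ℝ) ≤ k * hh := by positivity
      nlinarith
  have heq := hD.unique hfin
  have hM := norm_fwdDiff_iter_le m bumpC _ hh hhp.le (bumpC_contDiff m)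
    (norm_iteratedDeriv_bumpC m)
  have hub : ‖(z⁻¹ - 1) ^ m * a‖ ≤ (N + m) * (hh ^ m * (9 ^ m * (m.factorial : ℝ) ^ 2)) := by
    rw [heq]
    refine (norm_sum_le_of_le (n := fun _ => hh ^ m * (9 ^ m * (m.factorial : ℝ) ^ 2)) _ ?_).trans ?_
    · intro n _
      rw [norm_mul, norm_zpow, hz1, one_zpow, mul_one]
      exact hM _
    · rw [Finset.sum_const, Int.card_Ico, nsmul_eq_mul]
      apply le_of_eq
      congr 1
      rw [show ((N : ℤ) - -(m : ℤ)).toNat = N + m by omega]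
      push_cast; ring
  have hlow : (4 * δ) ^ m * ‖a‖ ≤ ‖(z⁻¹ - 1) ^ m * a‖ := by
    rw [norm_mul, norm_pow]
    gcongr
    exact norm_unit_sub_one h
  have hfac : (m.factorial : ℝ) ≤ (m : ℝ) ^ m := by exact_mod_cast Nat.factorial_le_pow m
  have h4 : 0 < (4 * δ) ^ m := by positivity
  rw [← mul_le_mul_iff_right₀ h4]
  refine (hlow.trans hub).trans ?_
  calc (N + m) * (hh ^ m * (9 ^ m * (m.factorial : ℝ) ^ 2))
      ≤ (N + m) * (hh ^ m * (9 ^ m * ((m : ℝ) ^ m) ^ 2)) := by gcongr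
    _ = _ := by
      rw [div_pow, mul_pow 9, mul_pow (4 * δ) (N : ℝ), hhh, inv_pow, ← pow_mul, ← pow_mul, mul_comm 2 m]
      field_simp

lemma summable_exp_intNorm {μ : ℝ} (hμ : 0 < μ) (d : ℕ) :
    Summable (fun k : Fin d → ℤ => Real.exp (-μ * intNorm k)) := by
  have h1 : Summable (fun n : ℤ => Real.exp (-μ * |(n : ℝ)|)) := by
    have h2 : Summable (fun n : ℕ => Real.exp (-μ * n)) := by
      have := Real.summable_exp_nat_mul_iff.mpr (neg_lt_zero.mpr hμ)
      simpa [mul_comm] using this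
    apply Summable.of_nat_of_neg <;> simpa using h2
  induction d with
  | zero => exact Summable.of_finite
  | succ d ih =>
    have h3 := h1.mul_of_nonneg ih (fun _ => (Real.exp_pos _).le) (fun _ => (Real.exp_pos _).le)
    rw [← (Fin.consEquiv (fun _ : Fin (d + 1) => ℤ)).summable_iff]
    refine h3.congr ?_
    rintro ⟨a, b⟩
    simp only [Function.comp, Fin.consEquiv, Equiv.coe_fn_mk, intNorm, Fin.sum_univ_succ,
      Fin.cons_zero, Fin.cons_succ]
    rw [← Real.exp_add]; congr 1; ring

lemma wbar_eq (x : ℝ) : wbar x = cbar * expNegInvGlue (x * (1 - x)) := by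
  unfold wbar
  split_ifs with h
  · have : 0 < x * (1 - x) := mul_pos h.1 (by linarith [h.2])
    simp [expNegInvGlue, not_le.mpr this]
  · rw [expNegInvGlue.zero_of_nonpos, mul_zero]
    by_contra hc
    push Not at hc
    apply h
    constructor <;> nlinarith

lemma sum_lower (N : ℕ) (hN : 3 ≤ N) :
    Real.exp (-6) ≤ ∑ n ∈ Finset.range N, expNegInvGlue ((n / N : ℝ) * (1 - n / N)) := by
  have hNR : (0 : ℝ) < N := by exact_mod_cast (by omega : 0 < N)
  have hmem : N / 2 ∈ Finset.range N := by rw [Finset.mem_range]; omega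
  refine le_trans ?_ (Finset.single_le_sum (fun n _ => expNegInvGlue.nonneg _) hmem)
  set x : ℝ := ((N / 2 : ℕ) : ℝ) / N with hx
  have h1 : 1 / 3 ≤ x := by
    rw [hx, div_le_div_iff₀ (by norm_num) hNR]
    have : 1 * N ≤ N / 2 * 3 := by omega
    exact_mod_cast this
  have h2 : x ≤ 1 / 2 := by
    rw [hx, div_le_div_iff₀ hNR (by norm_num)]
    have : N / 2 * 2 ≤ 1 * N := by omega
    exact_mod_cast this
  have h3 : 1 / 6 ≤ x * (1 - x) := by nlinarith
  rw [expNegInvGlue, if_neg (by linarith)]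
  apply Real.exp_le_exp.mpr
  rw [neg_le_neg_iff]
  have := inv_anti₀ (by norm_num : (0 : ℝ) < 1 / 6) h3
  rw [one_div, inv_inv] at this
  exact this

lemma small_freq_bound {α τ : ℝ} (hα : 0 < α) (hτ : 0 < τ) (N : ℕ) (hN : 1 ≤ N) (ω K : ℝ)
    (hK : 0 < K) (hKN : K ≤ (N : ℝ) ^ (1 / (τ + 1)))
    (h : ∀ n : ℤ, α / K ^ τ ≤ |ω - n|) :
    ‖∑ n ∈ Finset.range N, bumpC (n / N) * Complex.exp (2 * π * Complex.I * ω) ^ n‖ ≤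
      2 * N * Real.exp (1 - min 1 (√α / 3) * (N : ℝ) ^ (1 / (τ + 1) / 2)) := by
  set s := 1 / (τ + 1) with hs
  set c := min 1 (√α / 3) with hc
  have hNR : (1 : ℝ) ≤ N := by exact_mod_cast hN
  have hN0 : (0 : ℝ) < N := by linarith
  have hc0 : 0 < c := lt_min one_pos (by positivity)
  have hc1 : c ≤ 1 := min_le_left _ _
  have hc2 : c ^ 2 ≤ α / 9 := by
    have h1 : c ≤ √α / 3 := min_le_right _ _
    have h2 : c ^ 2 ≤ (√α / 3) ^ 2 := by gcongr
    rw [div_pow, Real.sq_sqrt hα.le] at h2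
    linarith
  have hs0 : 0 < s := by positivity
  have hs1 : s ≤ 1 := by rw [hs, div_le_one (by linarith)]; linarith
  set y := (N : ℝ) ^ (s / 2) with hy
  have hy0 : 0 < y := by positivity
  have hy2 : y ^ 2 = (N : ℝ) ^ s := by
    rw [hy, ← Real.rpow_natCast, ← Real.rpow_mul hN0.le]; congr 1; push_cast; ring
  set m := ⌊c * y⌋₊ with hm
  have hm1 : (m : ℝ) ≤ c * y := Nat.floor_le (by positivity)
  have hm2 : c * y < m + 1 := Nat.lt_floor_add_one _
  have hyN : y ≤ N := by
    calc y ≤ (N : ℝ) ^ (1 : ℝ) := Real.rpow_le_rpow_of_exponent_le hNR (by linarith)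
      _ = N := Real.rpow_one _
  have hmN : (m : ℝ) ≤ N := by nlinarith
  have hKτ : 0 < K ^ τ := by positivity
  have hδ : 0 < α / K ^ τ := by positivity
  have hb := exp_sum_bound N m (by omega) ω (α / K ^ τ) hδ h
  have hKle : K ^ τ * (N : ℝ) ^ s ≤ N := by
    calc K ^ τ * (N : ℝ) ^ s ≤ ((N : ℝ) ^ s) ^ τ * (N : ℝ) ^ s := by gcongr
      _ = (N : ℝ) ^ (1 : ℝ) := by
        rw [← Real.rpow_mul hN0.le, ← Real.rpow_add hN0]
        congr 1; rw [hs]; field_simp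
      _ = N := Real.rpow_one _
  have hδN : α * (N : ℝ) ^ s ≤ α / K ^ τ * N := by
    rw [div_mul_eq_mul_div, le_div_iff₀ hKτ]
    nlinarith
  have hm3 : 9 * (m : ℝ) ^ 2 ≤ α * (N : ℝ) ^ s := by
    have h1 : (m : ℝ) ^ 2 ≤ (c * y) ^ 2 := by gcongr
    rw [mul_pow, hy2] at h1
    have : 0 < (N : ℝ) ^ s := by positivity
    nlinarith
  have hq : 9 * (m : ℝ) ^ 2 / (4 * (α / K ^ τ) * N) ≤ Real.exp (-1) := by
    have h1 : 9 * (m : ℝ) ^ 2 / (4 * (α / K ^ τ) * N) ≤ 1 / 4 := by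
      rw [div_le_iff₀ (by positivity)]
      nlinarith
    refine h1.trans ?_
    rw [Real.exp_neg, one_div]
    exact inv_anti₀ (Real.exp_pos _) (by linarith [Real.exp_one_lt_d9])
  refine hb.trans ?_
  calc ((N : ℝ) + m) * (9 * (m : ℝ) ^ 2 / (4 * (α / K ^ τ) * N)) ^ m
      ≤ (N + N) * Real.exp (-1) ^ m := by gcongr
    _ = 2 * N * Real.exp (-m) := by rw [← Real.exp_nat_mul]; congr 1; ring; congr 1; ring
    _ ≤ _ := by
      gcongr
      linarith

lemma absorb {c ξ : ℝ} (hc : 0 < c) (hξ : 0 < ξ) : ∃ C : ℝ, 0 < C ∧ ∀ N : ℕ, 1 ≤ N →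
    (N : ℝ) * Real.exp (-c * (N : ℝ) ^ ξ) ≤ C * Real.exp (-(c / 2) * (N : ℝ) ^ ξ) := by
  obtain ⟨p, hp⟩ := exists_nat_ge (1 / ξ)
  refine ⟨p.factorial * (2 / c) ^ p, by positivity, ?_⟩
  intro N hN
  have hNR : (1 : ℝ) ≤ N := by exact_mod_cast hN
  set y := (N : ℝ) ^ ξ with hy
  have hy0 : 0 < y := by positivity
  have h1 : (N : ℝ) ≤ y ^ p := by
    rw [hy, ← Real.rpow_natCast, ← Real.rpow_mul (by positivity)]
    calc (N : ℝ) = (N : ℝ) ^ (1 : ℝ) := (Real.rpow_one _).symm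
      _ ≤ _ := by
        apply Real.rpow_le_rpow_of_exponent_le hNR
        rw [div_le_iff₀ hξ] at hp; linarith
  have h2 := Real.pow_div_factorial_le_exp (c / 2 * y) (by positivity) p
  have hf : (0 : ℝ) < p.factorial := by positivity
  rw [div_le_iff₀ hf, mul_pow] at h2
  have h3 : y ^ p ≤ p.factorial * (2 / c) ^ p * Real.exp (c / 2 * y) := by
    calc y ^ p = (2 / c) ^ p * ((c / 2) ^ p * y ^ p) := by
          rw [← mul_assoc, ← mul_pow]
          rw [show 2 / c * (c / 2) = 1 by field_simp]; simp
      _ ≤ (2 / c) ^ p * (Real.exp (c / 2 * y) * p.factorial) := by gcongr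
      _ = _ := by ring
  calc (N : ℝ) * Real.exp (-c * y)
      ≤ (p.factorial * (2 / c) ^ p * Real.exp (c / 2 * y)) * Real.exp (-c * y) := by
        gcongr; exact h1.trans h3
    _ = _ := by
        rw [mul_assoc, ← Real.exp_add]; congr 2; ring

lemma one_le_intNorm {d : ℕ} {k : Fin d → ℤ} (hk : k ≠ 0) : 1 ≤ intNorm k := by
  obtain ⟨i, hi⟩ := Function.ne_iff.mp hk
  have h1 : (1 : ℝ) ≤ |(k i : ℝ)| := by
    have : 1 ≤ |k i| := Int.one_le_abs hi
    exact_mod_cast this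
  exact h1.trans (Finset.single_le_sum (f := fun i => |(k i : ℝ)|)
    (fun _ _ => abs_nonneg _) (Finset.mem_univ i))

/-- universality of exponential convergence: for a Diophantine rotation
(`|k·ρ - n| ≥ α/‖k‖^τ`, `τ > d - 1`) and an analytic observable
(`‖f̂_k‖ ≤ c_f e^{-2μ‖k‖}`), the weighted Birkhoff average with the bump weight `w̄`
converges at the exponential rate `C exp(-c̃ N^ξ)`, uniformly in `θ`. -/
theorem stmt18
    {B : Type*} [NormedAddCommGroup B] [NormedSpace ℂ B] [CompleteSpace B]
    (d : ℕ) (hd : 1 ≤ d)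
    (f : (Fin d → ℝ) → B) (fhat : (Fin d → ℤ) → B)
    (hf : ∀ θ : Fin d → ℝ,
      HasSum (fun k : Fin d → ℤ =>
        Complex.exp (2 * π * Complex.I * (∑ i, (k i : ℝ) * θ i)) • fhat k) (f θ))
    (τ : ℝ) (hτ : (d : ℝ) - 1 < τ) (α : ℝ) (hα : 0 < α)
    (ρ : Fin d → ℝ)
    (hρ : ∀ k : Fin d → ℤ, k ≠ 0 → ∀ n : ℤ,
      α / intNorm k ^ τ ≤ |(∑ i, (k i : ℝ) * ρ i) - n|)
    (cf μ : ℝ) (hcf : 0 < cf) (hμ : 0 < μ)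
    (hdecay : ∀ k : Fin d → ℤ, k ≠ 0 → ‖fhat k‖ ≤ cf * Real.exp (-2 * μ * intNorm k)) :
    ∃ ξ ctil C : ℝ, ∃ N₀ : ℕ, 0 < ξ ∧ 0 < ctil ∧ 0 < C ∧
      ∀ N : ℕ, N₀ ≤ N → ∀ θ : Fin d → ℝ,
        ‖((∑ n ∈ Finset.range N, wbar (n / N) : ℝ) : ℂ)⁻¹ •
            (∑ n ∈ Finset.range N, ((wbar (n / N) : ℝ) : ℂ) • f (θ + (n : ℝ) • ρ)) -
          fhat 0‖ ≤ C * Real.exp (-ctil * (N : ℝ) ^ ξ) := by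
  have hτ0 : 0 < τ := by
    have : (1 : ℝ) ≤ d := by exact_mod_cast hd
    linarith
  set s := 1 / (τ + 1) with hs
  have hs0 : 0 < s := by positivity
  set c := min 1 (√α / 3) with hc
  have hc0 : 0 < c := lt_min one_pos (by positivity)
  have hξ : 0 < s / 2 := by positivity
  obtain ⟨C1, hC1, habs⟩ := absorb hc0 hξ
  set C2 := Real.exp 6 * (2 * Real.exp 1 * C1) + 1 with hC2
  have hC2p : 0 < C2 := by positivity
  set ct := min (c / 2) μ with hct
  have hct0 : 0 < ct := lt_min (by positivity) hμ
  have hS := summable_exp_intNorm hμ d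
  set S := ∑' k : Fin d → ℤ, Real.exp (-μ * intNorm k) with hSdef
  have hS0 : 0 ≤ S := tsum_nonneg fun _ => (Real.exp_pos _).le
  refine ⟨s / 2, ct, cf * C2 * S + 1, 3, hξ, hct0, by positivity, ?_⟩
  intro N hN θ
  have hNR : (1 : ℝ) ≤ N := by exact_mod_cast (by omega : 1 ≤ N)
  set y := (N : ℝ) ^ (s / 2) with hy
  have hy0 : 0 < y := by positivity
  set Ab := ∑ n ∈ Finset.range N, expNegInvGlue ((n / N : ℝ) * (1 - n / N)) with hAb
  have hAb6 : Real.exp (-6) ≤ Ab := sum_lower N hN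
  have hAb0 : 0 < Ab := (Real.exp_pos _).trans_le hAb6
  have hA : (∑ n ∈ Finset.range N, wbar (n / N) : ℝ) = cbar * Ab := by
    rw [hAb, Finset.mul_sum]
    exact Finset.sum_congr rfl fun n _ => wbar_eq _
  have hcb := cbar_pos
  -- frequencies and exponential sums
  set om : (Fin d → ℤ) → ℝ := fun k => ∑ i, (k i : ℝ) * ρ i with hom
  set z : (Fin d → ℤ) → ℂ := fun k => Complex.exp (2 * π * Complex.I * om k) with hz
  set T : (Fin d → ℤ) → ℂ := fun k => ∑ n ∈ Finset.range N, bumpC (n / N) * z k ^ n with hT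
  set e : (Fin d → ℤ) → ℂ := fun k =>
    Complex.exp (2 * π * Complex.I * (∑ i, (k i : ℝ) * θ i)) with he
  have hzn : ∀ k, ‖z k‖ = 1 := by
    intro k
    rw [hz]
    simp only
    rw [show 2 * π * Complex.I * om k = Complex.I * ((2 * π * om k : ℝ) : ℂ) by push_cast; ring]
    exact Complex.norm_exp_I_mul_ofReal _
  have hen : ∀ k, ‖e k‖ = 1 := by
    intro k
    rw [he]
    simp only
    rw [show 2 * π * Complex.I * (∑ i, (k i : ℝ) * θ i)
      = Complex.I * ((2 * π * (∑ i, (k i : ℝ) * θ i) : ℝ) : ℂ) by push_cast; ring]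
    exact Complex.norm_exp_I_mul_ofReal _
  have hTle : ∀ k, ‖T k‖ ≤ Ab := by
    intro k
    refine norm_sum_le_of_le _ ?_
    intro n _
    rw [norm_mul, norm_pow, hzn, one_pow, mul_one, bumpC, Complex.norm_real, Real.norm_eq_abs,
      abs_of_nonneg (expNegInvGlue.nonneg _)]
  have hsum : HasSum (fun k => (e k * ((Ab : ℂ)⁻¹ * T k)) • fhat k)
      (((∑ n ∈ Finset.range N, wbar (n / N) : ℝ) : ℂ)⁻¹ •
            (∑ n ∈ Finset.range N, ((wbar (n / N) : ℝ) : ℂ) • f (θ + (n : ℝ) • ρ))) := by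
    have h1 := (hasSum_sum (s := Finset.range N) fun n _ =>
      (hf (θ + (n : ℝ) • ρ)).const_smul ((wbar (n / N) : ℝ) : ℂ)).const_smul
        (((∑ n ∈ Finset.range N, wbar (n / N) : ℝ) : ℂ)⁻¹)
    refine h1.congr_fun ?_
    intro k
    simp only [smul_smul]
    rw [← Finset.sum_smul, smul_smul]
    congr 1
    rw [hA, hT]
    simp only
    have hcb' : (cbar : ℂ) ≠ 0 := by exact_mod_cast hcb.ne'
    have hAb' : (Ab : ℂ) ≠ 0 := by exact_mod_cast hAb0.ne'
    have h2 : ∀ n ∈ Finset.range N, ((wbar (n / N) : ℝ) : ℂ) *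
        Complex.exp (2 * π * Complex.I * (∑ i, (k i : ℝ) * (θ + (n : ℝ) • ρ) i)) =
        cbar * e k * (bumpC (n / N) * z k ^ n) := by
      intro n _
      rw [wbar_eq, bumpC]
      have : Complex.exp (2 * π * Complex.I * (∑ i, (k i : ℝ) * (θ + (n : ℝ) • ρ) i))
          = e k * z k ^ n := by
        rw [he, hz]
        simp only
        rw [← Complex.exp_nat_mul, ← Complex.exp_add]
        congr 1
        rw [hom]
        push_cast
        simp only [Pi.add_apply, Pi.smul_apply, smul_eq_mul, mul_add, Finset.sum_add_distrib]
        push_cast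
        simp only [mul_add, Finset.sum_add_distrib, Finset.mul_sum]
        congr 1
        apply Finset.sum_congr rfl
        intro i _
        ring
      rw [this]
      push_cast
      ring
    rw [Finset.sum_congr rfl h2, ← Finset.mul_sum]
    push_cast
    field_simp
  have hzero : HasSum (fun k : Fin d → ℤ => if k = 0 then fhat 0 else 0) (fhat 0) :=
    hasSum_ite_eq 0 (fhat 0)
  have hdiff := hsum.sub hzero
  have hbound : HasSum (fun k : Fin d → ℤ => cf * C2 * Real.exp (-ct * y) * Real.exp (-μ * intNorm k))
      (cf * C2 * Real.exp (-ct * y) * S) := hS.hasSum.mul_left _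
  have hfinal := hdiff.norm_le_of_bounded hbound ?_
  · refine hfinal.trans ?_
    have := Real.exp_pos (-ct * y)
    nlinarith
  intro k
  by_cases hk : k = 0
  · subst hk
    have h1 : e 0 * ((Ab : ℂ)⁻¹ * T 0) = 1 := by
      have hAb' : (Ab : ℂ) ≠ 0 := by exact_mod_cast hAb0.ne'
      have : T 0 = Ab := by
        simp [hT, hz, hom, hAb, bumpC]
      rw [this, inv_mul_cancel₀ hAb']
      simp [he]
    rw [h1, one_smul, if_pos rfl, sub_self, norm_zero]
    positivity
  · rw [if_neg hk, sub_zero, norm_smul, norm_mul, hen, one_mul, norm_mul, norm_inv,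
      Complex.norm_real, Real.norm_eq_abs, abs_of_pos hAb0]
    have hK1 := one_le_intNorm hk
    set K := intNorm k with hK
    have hR : Real.exp (-μ * K) * (Ab⁻¹ * ‖T k‖) ≤ C2 * Real.exp (-ct * y) := by
      rcases le_or_gt K ((N : ℝ) ^ s) with hKN | hKN
      · have h1 := small_freq_bound hα hτ0 N (by omega) (om k) K (by linarith) hKN (hρ k hk)
        have h2 := habs N (by omega)
        have h3 : ‖T k‖ ≤ 2 * Real.exp 1 * (C1 * Real.exp (-(c / 2) * y)) := by
          refine h1.trans ?_
          calc 2 * (N : ℝ) * Real.exp (1 - c * y)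
              = 2 * Real.exp 1 * (N * Real.exp (-c * y)) := by
                rw [show 1 - c * y = 1 + -c * y by ring, Real.exp_add]; ring
            _ ≤ _ := by gcongr
        have h4 : Ab⁻¹ ≤ Real.exp 6 := by
          have := inv_anti₀ (Real.exp_pos _) hAb6
          rwa [← Real.exp_neg, neg_neg] at this
        have h5 : Real.exp (-μ * K) ≤ 1 := Real.exp_le_one_iff.mpr (by nlinarith)
        have h6 : Real.exp (-(c / 2) * y) ≤ Real.exp (-ct * y) := by
          apply Real.exp_le_exp.mpr
          have : ct ≤ c / 2 := min_le_left _ _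
          nlinarith
        calc Real.exp (-μ * K) * (Ab⁻¹ * ‖T k‖)
            ≤ 1 * (Real.exp 6 * (2 * Real.exp 1 * (C1 * Real.exp (-ct * y)))) := by
              gcongr
              refine h3.trans ?_
              gcongr
          _ = (C2 - 1) * Real.exp (-ct * y) := by rw [hC2]; ring
          _ ≤ C2 * Real.exp (-ct * y) := by gcongr; linarith
      · have h1 : Ab⁻¹ * ‖T k‖ ≤ 1 := by
          rw [inv_mul_le_iff₀ hAb0, mul_one]; exact hTle k
        have h2 : y ≤ K := by
          refine le_trans ?_ hKN.le
          exact Real.rpow_le_rpow_of_exponent_le hNR (by linarith)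
        have h3 : Real.exp (-μ * K) ≤ Real.exp (-ct * y) := by
          apply Real.exp_le_exp.mpr
          have : ct ≤ μ := min_le_right _ _
          nlinarith
        have hC2' : 1 ≤ C2 := by
          have : 0 ≤ Real.exp 6 * (2 * Real.exp 1 * C1) := by positivity
          linarith
        calc Real.exp (-μ * K) * (Ab⁻¹ * ‖T k‖) ≤ Real.exp (-ct * y) * 1 := by gcongr
          _ = 1 * Real.exp (-ct * y) := by ring
          _ ≤ _ := by gcongr
    calc Ab⁻¹ * ‖T k‖ * ‖fhat k‖ ≤ Ab⁻¹ * ‖T k‖ * (cf * Real.exp (-2 * μ * K)) := by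
          gcongr
          exact hdecay k hk
      _ = cf * Real.exp (-μ * K) * (Real.exp (-μ * K) * (Ab⁻¹ * ‖T k‖)) := by
          rw [show -2 * μ * K = -μ * K + -μ * K by ring, Real.exp_add]; ring
      _ ≤ cf * Real.exp (-μ * K) * (C2 * Real.exp (-ct * y)) := by gcongr
      _ = _ := by ring
end
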